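/- There exist, on a common probability space, a linear Brownian motion B, the zero process 0, and an a.s. finite stopping time S of the completed natural filtration of B (namely the first hitting time of 0 by B after time 1) such that B_S 1_{{S<∞}} = 0 = 0_S 1_{{S<∞}} a.s. and (S, B_S) has the same joint law as (S, 0_S), yet B and the zero process do not have the same law. Hence equality of the laws of (X^1_{T^1} 1_{{T^1<∞}}, T^1) and (X^2_{T^2} 1_{{T^2<∞}}, T^2) does not imply equality of the laws of X^1 and X^2. -/

import Mathlib

open MeasureTheory ProbabilityTheory Filter Set
open scoped NNReal ENNReal

noncomputable section

instance optMS {α : Type*} [MeasurableSpace α] : MeasurableSpace (Option α) :=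
  MeasurableSpace.comap (fun o => o.elim (Sum.inl ()) Sum.inr) inferInstance

variable {Ω : Type*} {mΩ : MeasurableSpace Ω} {d : ℕ}

/-- Extend a nonnegative Borel function `g` on `ℝ^d` by `0` at the cemetery `∂ = none`. -/
def kval (g : (Fin d → ℝ) → ℝ≥0∞) : Option (Fin d → ℝ) → ℝ≥0∞ := fun x => x.elim 0 g

/-- Difference in `ℝ^d ∪ {∂}`, with the convention `∂ ± x = x ± ∂ = ∂`. -/
def osub : Option (Fin d → ℝ) → Option (Fin d → ℝ) → Option (Fin d → ℝ)
  | some a, some b => some (a - b)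
  | _, _ => none

/-- Sum in `ℝ^d ∪ {∂}`, with the convention `∂ ± x = x ± ∂ = ∂`. -/
def oadd : Option (Fin d → ℝ) → Option (Fin d → ℝ) → Option (Fin d → ℝ)
  | some a, some b => some (a + b)
  | _, _ => none

/-- The lifetime `ζ := inf {t > 0 : X t = ∂}` (`= ∞` if the set is empty). -/
def lifetime (X : ℝ≥0 → Ω → Option (Fin d → ℝ)) (ω : Ω) : ℝ≥0∞ :=
  sInf ((fun s : ℝ≥0 => (s : ℝ≥0∞)) '' {s : ℝ≥0 | 0 < s ∧ X s ω = none})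

/-- The `ℝ^d`-valued path of `X`, read as `0` at the cemetery (used only to express
path regularity on `[0, ζ)`). -/
def pkPath (X : ℝ≥0 → Ω → Option (Fin d → ℝ)) (ω : Ω) (t : ℝ≥0) : Fin d → ℝ :=
  (X t ω).getD 0

/-- A possibly killed `ℝ^d`-valued Lévy process `X` in the filtration `F` under `P`. -/
structure IsPKLevy (P : Measure Ω) (F : Filtration ℝ≥0 mΩ)
    (X : ℝ≥0 → Ω → Option (Fin d → ℝ)) : Prop where
  adapted : ∀ t, Measurable[F t] (X t)
  dead : ∀ ω, ∀ t : ℝ≥0, lifetime X ω ≤ t → X t ω = none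
  rightCont : ∀ ω, ∀ t : ℝ≥0, (t : ℝ≥0∞) < lifetime X ω →
    ContinuousWithinAt (pkPath X ω) (Set.Ici t) t
  leftLim : ∀ ω, ∀ t : ℝ≥0, 0 < t → (t : ℝ≥0∞) ≤ lifetime X ω →
    ∃ l, Tendsto (pkPath X ω) (nhdsWithin t (Set.Iio t)) (nhds l)
  init : ∀ᵐ ω ∂P, X 0 ω = some 0
  alive : ∀ᵐ ω ∂P, 0 < lifetime X ω
  increments : ∀ s t : ℝ≥0, s ≤ t → ∀ g : (Fin d → ℝ) → ℝ≥0∞, Measurable g →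
    ∀ A : Set Ω, MeasurableSet[F s] A →
      ∫⁻ ω in A, kval g (osub (X t ω) (X s ω)) ∂P
        = P (A ∩ {ω | (s : ℝ≥0∞) < lifetime X ω}) * ∫⁻ ω, kval g (X (t - s) ω) ∂P

/-- An `[0,∞]`-valued stopping time of the filtration `F`. -/
def IsStoppingTimeE (F : Filtration ℝ≥0 mΩ) (T : Ω → ℝ≥0∞) : Prop :=
  ∀ t : ℝ≥0, MeasurableSet[F t] {ω | T ω ≤ (t : ℝ≥0∞)}

/-- The law of `X` observed on the random interval `[0, T] ∩ [0, ∞)`: outside the interval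
the observed process is set to the adjoined state `↑` (the outer `none`). -/
def restLawIcc (P : Measure Ω) (X : ℝ≥0 → Ω → Option (Fin d → ℝ)) (T : Ω → ℝ≥0∞) :
    Measure (ℝ≥0 → Option (Option (Fin d → ℝ))) :=
  Measure.map (fun ω t => if (t : ℝ≥0∞) ≤ T ω then some (X t ω) else none) P

/-- The law of `X` observed on the random interval `[0, T)`. -/
def restLawIco (P : Measure Ω) (X : ℝ≥0 → Ω → Option (Fin d → ℝ)) (T : Ω → ℝ≥0∞) :
    Measure (ℝ≥0 → Option (Option (Fin d → ℝ))) :=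
  Measure.map (fun ω t => if (t : ℝ≥0∞) < T ω then some (X t ω) else none) P

/-- The law of the process `X` under `P`. -/
def pkLaw (P : Measure Ω) (X : ℝ≥0 → Ω → Option (Fin d → ℝ)) :
    Measure (ℝ≥0 → Option (Fin d → ℝ)) :=
  Measure.map (fun ω t => X t ω) P

/-- An (unkilled) Lévy process with values in a normed abelian group `V`. -/
structure IsLevy {V : Type*} [NormedAddCommGroup V] [MeasurableSpace V]
    (P : Measure Ω) (F : Filtration ℝ≥0 mΩ) (X : ℝ≥0 → Ω → V) : Prop where
  adapted : ∀ t, Measurable[F t] (X t)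
  rightCont : ∀ ω, ∀ t : ℝ≥0, ContinuousWithinAt (fun s => X s ω) (Set.Ici t) t
  leftLim : ∀ ω, ∀ t : ℝ≥0, 0 < t → ∃ l, Tendsto (fun s => X s ω) (nhdsWithin t (Set.Iio t)) (nhds l)
  init : ∀ᵐ ω ∂P, X 0 ω = 0
  increments : ∀ s t : ℝ≥0, s ≤ t → ∀ g : V → ℝ≥0∞, Measurable g →
    ∀ A : Set Ω, MeasurableSet[F s] A →
      ∫⁻ ω in A, g (X t ω - X s ω) ∂P = P A * ∫⁻ ω, g (X (t - s) ω) ∂P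

/-- A standard linear Brownian motion in the filtration `F` under `P`: a Lévy process with
continuous paths whose time-`t` marginal is `N(0, t)`. -/
def IsBM {Ω : Type*} {mΩ : MeasurableSpace Ω} (P : Measure Ω) (F : Filtration ℝ≥0 mΩ)
    (B : ℝ≥0 → Ω → ℝ) : Prop :=
  IsLevy P F B ∧ (∀ ω, Continuous fun t => B t ω) ∧
    ∀ t : ℝ≥0, Measure.map (B t) P = ProbabilityTheory.gaussianReal 0 t

/-! ### The Schauder (Lévy–Ciesielski) system -/

/-- The tent function on `[0,1]`. -/
def tent (x : ℝ) : ℝ := max 0 (1 - |2 * x - 1|)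

lemma tent_cont : Continuous tent := by unfold tent; fun_prop

lemma tent_nonneg (x : ℝ) : 0 ≤ tent x := le_max_left _ _

lemma tent_le_one (x : ℝ) : tent x ≤ 1 := by
  unfold tent
  exact max_le zero_le_one (by linarith [abs_nonneg (2 * x - 1)])

lemma tent_of_nonpos {x : ℝ} (h : x ≤ 0) : tent x = 0 := by
  unfold tent
  rw [abs_of_nonpos (by linarith)]; exact max_eq_left (by linarith)

lemma tent_of_one_le {x : ℝ} (h : 1 ≤ x) : tent x = 0 := by
  unfold tent
  rw [abs_of_nonneg (by linarith)]; exact max_eq_left (by linarith)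

lemma tent_left {x : ℝ} (h : 0 ≤ x) (h' : x ≤ 1 / 2) : tent x = 2 * x := by
  unfold tent
  rw [abs_of_nonpos (by linarith), max_eq_right (by linarith)]; ring

lemma tent_right {x : ℝ} (h : 1 / 2 ≤ x) (h' : x ≤ 1) : tent x = 2 - 2 * x := by
  unfold tent
  rw [abs_of_nonneg (by linarith), max_eq_right (by linarith)]; ring

lemma tent_sum (m : ℕ) : ∀ x : ℝ, (x ≤ 0 → ∑ k ∈ Finset.range m, tent (x - k) = 0) ∧
    ∑ k ∈ Finset.range m, tent (x - k) ≤ 1 := by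
  induction m with
  | zero => intro x; simp
  | succ m ih =>
    intro x
    rw [Finset.sum_range_succ']
    have e : ∀ k : ℕ, tent (x - ((k + 1 : ℕ) : ℝ)) = tent ((x - 1) - k) := by
      intro k; congr 1; push_cast; ring
    simp only [e, Nat.cast_zero, sub_zero]
    obtain ⟨h1, h2⟩ := ih (x - 1)
    constructor
    · intro hx
      rw [h1 (by linarith), tent_of_nonpos hx, add_zero]
    · rcases le_total x 1 with hx | hx
      · rw [h1 (by linarith), zero_add]; exact tent_le_one x
      · rw [tent_of_one_le hx, add_zero]; exact h2

/-- Covariance of the `N`-th partial sum of the Brownian bridge. -/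
def KN (N : ℕ) (u v : ℝ) : ℝ :=
  ∑ n ∈ Finset.range N, (1 / 4) * (1 / 2) ^ n *
    ∑ k ∈ Finset.range (2 ^ n), tent (2 ^ n * u - k) * tent (2 ^ n * v - k)

/-- Covariance of the Brownian bridge, extended by zero. -/
def GG (u v : ℝ) : ℝ := max 0 (min u v) * max 0 (1 - max u v)

lemma KN_succ (N : ℕ) (u v : ℝ) :
    KN (N + 1) u v = 1 / 4 * (tent u * tent v)
      + 1 / 2 * (KN N (2 * u) (2 * v) + KN N (2 * u - 1) (2 * v - 1)) := by
  unfold KN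
  rw [Finset.sum_range_succ', add_comm, ← Finset.sum_add_distrib]
  refine congr_arg₂ (· + ·) ?_ ?_
  · simp
  · rw [Finset.mul_sum]
    apply Finset.sum_congr rfl
    intro n _
    rw [pow_succ 2 n, mul_two, Finset.sum_range_add]
    have e1 : ∀ (w : ℝ) (k : ℕ), (2 : ℝ) ^ (n + 1) * w - k = 2 ^ n * (2 * w) - k := by
      intro w k; ring
    have e2 : ∀ (w : ℝ) (k : ℕ), (2 : ℝ) ^ (n + 1) * w - ((2 ^ n + k : ℕ) : ℝ)
        = 2 ^ n * (2 * w - 1) - k := by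
      intro w k; push_cast; ring
    simp only [e2]
    simp only [e1]
    ring

lemma GG_zero_left {u v : ℝ} (h : u ≤ 0 ∨ 1 ≤ u) : GG u v = 0 := by
  unfold GG
  rcases h with h | h
  · rw [max_eq_left ((min_le_left _ _).trans h), zero_mul]
  · rw [max_eq_left (a := (0 : ℝ)) (b := 1 - max u v) (by linarith [le_max_left u v]), mul_zero]

lemma GG_comm (u v : ℝ) : GG u v = GG v u := by
  unfold GG; rw [min_comm, max_comm u v]

lemma GG_of_le {u v : ℝ} (h0 : 0 ≤ u) (h : u ≤ v) (h1 : v ≤ 1) : GG u v = u * (1 - v) := by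
  unfold GG
  rw [min_eq_left h, max_eq_right h, max_eq_right h0, max_eq_right (by linarith)]

lemma GG_fe (u v : ℝ) : GG u v = 1 / 4 * (tent u * tent v)
      + 1 / 2 * (GG (2 * u) (2 * v) + GG (2 * u - 1) (2 * v - 1)) := by
  wlog h : u ≤ v generalizing u v
  · rw [GG_comm u v, this v u (le_of_not_ge h), GG_comm (2 * u), GG_comm (2 * u - 1)]; ring
  rcases le_total u 0 with hu | hu
  · rw [GG_zero_left (.inl hu), tent_of_nonpos hu, GG_zero_left (.inl (by linarith)),
      GG_zero_left (.inl (by linarith))]; ring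
  rcases le_total 1 v with hv | hv
  · rw [GG_comm u, GG_comm (2 * u), GG_comm (2 * u - 1), GG_zero_left (.inr hv),
      tent_of_one_le hv, GG_zero_left (.inr (by linarith)),
      GG_zero_left (.inr (by linarith))]; ring
  rw [GG_of_le hu h hv]
  rcases le_total u (1 / 2) with hu2 | hu2
  · rw [tent_left hu hu2, GG_zero_left (u := 2 * u - 1) (.inl (by linarith))]
    rcases le_total v (1 / 2) with hv2 | hv2
    · rw [tent_left (by linarith) hv2, GG_of_le (by linarith) (by linarith) (by linarith)]; ring
    · rw [tent_right (by linarith) hv, GG_comm, GG_zero_left (.inr (by linarith))]; ring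
  · rw [tent_right hu2 (by linarith), tent_right (by linarith) hv,
      GG_zero_left (u := 2 * u) (.inr (by linarith)),
      GG_of_le (by linarith) (by linarith) (by linarith)]; ring

lemma GG_le (u v : ℝ) : |GG u v| ≤ 1 := by
  wlog h : u ≤ v generalizing u v
  · rw [GG_comm]; exact this v u (le_of_not_ge h)
  rcases le_total u 0 with hu | hu
  · rw [GG_zero_left (.inl hu)]; simp
  rcases le_total 1 v with hv | hv
  · rw [GG_comm, GG_zero_left (.inr hv)]; simp
  rw [GG_of_le hu h hv, abs_le]
  constructor <;> nlinarith

lemma KN_err (N : ℕ) : ∀ u v : ℝ, (u ≤ 0 ∨ 1 ≤ u → GG u v - KN N u v = 0) ∧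
    |GG u v - KN N u v| ≤ (1 / 2) ^ N := by
  induction N with
  | zero =>
    intro u v
    simp only [KN, Finset.range_zero, Finset.sum_empty, sub_zero, pow_zero]
    exact ⟨GG_zero_left, GG_le u v⟩
  | succ N ih =>
    intro u v
    have e : GG u v - KN (N + 1) u v = 1 / 2 * ((GG (2 * u) (2 * v) - KN N (2 * u) (2 * v))
        + (GG (2 * u - 1) (2 * v - 1) - KN N (2 * u - 1) (2 * v - 1))) := by
      rw [KN_succ, GG_fe u v]; ring
    obtain ⟨a1, a2⟩ := ih (2 * u) (2 * v)
    obtain ⟨b1, b2⟩ := ih (2 * u - 1) (2 * v - 1)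
    rw [e]
    constructor
    · rintro (h | h)
      · rw [a1 (.inl (by linarith)), b1 (.inl (by linarith))]; ring
      · rw [a1 (.inr (by linarith)), b1 (.inr (by linarith))]; ring
    · rw [abs_mul, pow_succ, abs_of_pos (by norm_num : (0 : ℝ) < 1 / 2), mul_comm]
      refine mul_le_mul_of_nonneg_right ?_ (by norm_num)
      rcases le_total u (1 / 2) with h | h
      · rw [b1 (.inl (by linarith)), add_zero]; exact a2
      · rw [a1 (.inr (by linarith)), zero_add]; exact b2

lemma KN_tendsto (u v : ℝ) : Tendsto (fun N => KN N u v) atTop (nhds (GG u v)) := by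
  rw [tendsto_iff_norm_sub_tendsto_zero]
  refine squeeze_zero (fun _ => norm_nonneg _) (fun N => ?_)
    (tendsto_pow_atTop_nhds_zero_of_lt_one (r := (1 / 2 : ℝ)) (by norm_num) (by norm_num))
  rw [Real.norm_eq_abs, abs_sub_comm]
  exact (KN_err N u v).2

/-- Time change `[0,∞) → [0,1)`. -/
def tau (t : ℝ≥0) : ℝ := (t : ℝ) / (1 + t)

lemma tau_cont : Continuous tau := by
  unfold tau
  refine Continuous.div (by fun_prop) (by fun_prop) fun t => by positivity

lemma GG_tau (s t : ℝ≥0) (h : s ≤ t) : (1 + (s : ℝ)) * (1 + t) * GG (tau s) (tau t) = s := by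
  have hs : (0 : ℝ) ≤ s := s.2
  have ht : (0 : ℝ) ≤ t := t.2
  have hst : (s : ℝ) ≤ t := h
  rw [GG_of_le]
  · unfold tau; field_simp; ring
  · unfold tau; positivity
  · unfold tau; rw [div_le_div_iff₀ (by positivity) (by positivity)]; nlinarith
  · unfold tau; rw [div_le_one (by positivity)]; linarith

/-! ### The random series -/

/-- Sample space. -/
abbrev Om : Type := ℕ × ℕ → ℝ

/-- Countable product of standard Gaussians. -/
def PP : Measure Om := Measure.infinitePi fun _ => gaussianReal 0 1

instance : IsProbabilityMeasure PP := by unfold PP; infer_instance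

/-- The `n`-th level of the Schauder expansion. -/
def lev (n : ℕ) (u : ℝ) (ω : Om) : ℝ :=
  (√2)⁻¹ ^ n / 2 * ∑ k ∈ Finset.range (2 ^ n), tent (2 ^ n * u - k) * ω (n, k)

lemma lev_cont (n : ℕ) (ω : Om) : Continuous fun u => lev n u ω := by
  unfold lev
  have := tent_cont
  fun_prop

lemma lev_meas (n : ℕ) (u : ℝ) : Measurable fun ω => lev n u ω := by
  unfold lev
  fun_prop

/-- Good paths. -/
def Good : Set Om := {ω | ∃ M : ℕ, ∀ n k : ℕ, k < 2 ^ n → |ω (n, k)| ≤ M * (4 / 3) ^ n}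

lemma Good_meas : MeasurableSet Good := by
  have : Good = ⋃ M : ℕ, ⋂ n : ℕ, ⋂ k : ℕ, ⋂ _ : k < 2 ^ n,
      {ω : Om | |ω (n, k)| ≤ M * (4 / 3) ^ n} := by
    ext ω; simp [Good]
  rw [this]
  refine .iUnion fun M => .iInter fun n => .iInter fun k => .iInter fun _ => ?_
  exact measurableSet_le (by fun_prop) measurable_const

lemma lev_bound {ω : Om} {M : ℕ} (h : ∀ n k : ℕ, k < 2 ^ n → |ω (n, k)| ≤ M * (4 / 3) ^ n)
    (n : ℕ) (u : ℝ) : ‖lev n u ω‖ ≤ M * ((√2)⁻¹ * (4 / 3)) ^ n := by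
  have h1 : |∑ k ∈ Finset.range (2 ^ n), tent (2 ^ n * u - k) * ω (n, k)| ≤ M * (4 / 3) ^ n := by
    calc |∑ k ∈ Finset.range (2 ^ n), tent (2 ^ n * u - k) * ω (n, k)|
        ≤ ∑ k ∈ Finset.range (2 ^ n), |tent (2 ^ n * u - k) * ω (n, k)| :=
          Finset.abs_sum_le_sum_abs _ _
      _ ≤ ∑ k ∈ Finset.range (2 ^ n), tent (2 ^ n * u - k) * (M * (4 / 3) ^ n) := by
          refine Finset.sum_le_sum fun k hk => ?_
          rw [abs_mul, abs_of_nonneg (tent_nonneg _)]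
          exact mul_le_mul_of_nonneg_left (h n k (Finset.mem_range.1 hk)) (tent_nonneg _)
      _ = (∑ k ∈ Finset.range (2 ^ n), tent (2 ^ n * u - k)) * (M * (4 / 3) ^ n) := by
          rw [Finset.sum_mul]
      _ ≤ 1 * (M * (4 / 3) ^ n) :=
          mul_le_mul_of_nonneg_right (tent_sum _ _).2 (by positivity)
      _ = _ := one_mul _
  have h0 : 0 ≤ (√2)⁻¹ ^ n := by positivity
  unfold lev
  rw [Real.norm_eq_abs, abs_mul, abs_of_nonneg (by positivity), mul_pow]
  calc (√2)⁻¹ ^ n / 2 * _ ≤ (√2)⁻¹ ^ n * (M * (4 / 3) ^ n) :=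
        mul_le_mul (by linarith) h1 (abs_nonneg _) h0
    _ = _ := by ring

lemma ratio_lt : (√2)⁻¹ * (4 / 3) < 1 := by
  have : (4 / 3 : ℝ) < √2 := Real.lt_sqrt_of_sq_lt (by norm_num)
  rw [inv_mul_lt_iff₀ (by positivity)]; linarith

lemma lev_summable_bound (M : ℕ) : Summable fun n : ℕ => M * ((√2)⁻¹ * (4 / 3)) ^ n :=
  (summable_geometric_of_lt_one (by positivity) ratio_lt).mul_left _

/-- The Brownian motion. -/
def BB (t : ℝ≥0) (ω : Om) : ℝ :=
  Good.indicator (fun ω => (1 + (t : ℝ)) * ∑' n, lev n (tau t) ω) ω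

/-- Partial sums. -/
def BN (N : ℕ) (t : ℝ≥0) (ω : Om) : ℝ :=
  (1 + (t : ℝ)) * ∑ n ∈ Finset.range N, lev n (tau t) ω

lemma BN_meas (N : ℕ) (t : ℝ≥0) : Measurable (BN N t) := by
  unfold BN
  have := fun n => lev_meas n (tau t)
  fun_prop

lemma BB_cont (ω : Om) : Continuous fun t => BB t ω := by
  unfold BB
  by_cases h : ω ∈ Good
  · simp only [indicator_of_mem h]
    obtain ⟨M, hM⟩ := h
    refine Continuous.mul (by fun_prop) ?_
    have := continuous_tsum (fun n => lev_cont n ω) (lev_summable_bound M)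
      (fun n u => lev_bound hM n u)
    exact this.comp tau_cont
  · simp only [indicator_of_notMem h]; fun_prop

lemma BN_tendsto {ω : Om} (h : ω ∈ Good) (t : ℝ≥0) :
    Tendsto (fun N => BN N t ω) atTop (nhds (BB t ω)) := by
  unfold BB BN
  rw [indicator_of_mem h]
  obtain ⟨M, hM⟩ := h
  have : Summable fun n => lev n (tau t) ω :=
    Summable.of_norm_bounded (lev_summable_bound M) fun n => lev_bound hM n _
  exact this.hasSum.tendsto_sum_nat.const_mul _

lemma BB_meas (t : ℝ≥0) : Measurable (BB t) := by
  refine measurable_of_tendsto_metrizable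
    (f := fun N => Good.indicator (BN N t)) (fun N => (BN_meas N t).indicator Good_meas) ?_
  rw [tendsto_pi_nhds]
  intro ω
  by_cases h : ω ∈ Good
  · simp only [indicator_of_mem h]; exact BN_tendsto h t
  · simp only [indicator_of_notMem h, BB]; exact tendsto_const_nhds

lemma coord_law (p : ℕ × ℕ) : HasLaw (fun ω : Om => ω p) (gaussianReal 0 1) PP :=
  ⟨(measurable_pi_apply p).aemeasurable, Measure.infinitePi_map_eval _ p⟩

lemma ae_good : ∀ᵐ ω ∂PP, ω ∈ Good := by
  have hC : ∫⁻ x, ENNReal.ofReal (x ^ 4) ∂(gaussianReal 0 1) ≠ ⊤ := by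
    have h1 := (memLp_id_gaussianReal (μ := 0) (v := 1) 4).integrable_norm_pow (by norm_num)
    have h2 : Integrable (fun x : ℝ => x ^ 4) (gaussianReal 0 1) := by
      refine h1.congr (ae_of_all _ fun x => ?_)
      exact Even.pow_abs (by decide) x
    exact h2.lintegral_lt_top.ne
  set C := ∫⁻ x, ENNReal.ofReal (x ^ 4) ∂(gaussianReal 0 1) with hCdef
  have hcoord : ∀ p : ℕ × ℕ, ∫⁻ ω : Om, ENNReal.ofReal (ω p ^ 4) ∂PP = C := by
    intro p
    exact (coord_law p).lintegral_comp (f := fun x : ℝ => ENNReal.ofReal (x ^ 4))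
      (by fun_prop)
  have hm : ∀ n : ℕ, Measurable (fun ω : Om => ∑ k ∈ Finset.range (2 ^ n),
      (3 : ℝ≥0∞)⁻¹ ^ n * ENNReal.ofReal (ω (n, k) ^ 4)) := fun n => by
    refine Finset.measurable_sum _ fun k _ => ?_
    fun_prop
  have hY : ∫⁻ ω : Om, ∑' n : ℕ, ∑ k ∈ Finset.range (2 ^ n),
      (3 : ℝ≥0∞)⁻¹ ^ n * ENNReal.ofReal (ω (n, k) ^ 4) ∂PP ≠ ⊤ := by
    rw [lintegral_tsum (fun n => (hm n).aemeasurable)]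
    have : ∀ n : ℕ, ∫⁻ ω : Om, ∑ k ∈ Finset.range (2 ^ n),
      (3 : ℝ≥0∞)⁻¹ ^ n * ENNReal.ofReal (ω (n, k) ^ 4) ∂PP = (2 / 3) ^ n * C := by
      intro n
      rw [lintegral_finsetSum _ (fun k _ => by fun_prop)]
      simp_rw [lintegral_const_mul _ (show Measurable (fun ω : Om =>
        ENNReal.ofReal (ω (n, _) ^ 4)) by fun_prop), hcoord]
      simp only [Finset.sum_const, Finset.card_range, nsmul_eq_mul]
      rw [div_eq_mul_inv, mul_pow, mul_assoc]
      push_cast; rfl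
    simp_rw [this]
    rw [ENNReal.tsum_mul_right, ENNReal.tsum_geometric]
    refine ENNReal.mul_ne_top (ENNReal.inv_ne_top.2 ?_) hC
    refine (tsub_pos_of_lt ?_).ne'
    exact ENNReal.div_lt_of_lt_mul (by norm_num)
  have hfin := ae_lt_top (Measurable.tsum hm) hY
  filter_upwards [hfin] with ω hω
  obtain ⟨M, hM⟩ := ENNReal.exists_nat_gt hω.ne
  refine ⟨M + 1, fun n k hk => ?_⟩
  have h1 : (3 : ℝ≥0∞)⁻¹ ^ n * ENNReal.ofReal (ω (n, k) ^ 4) ≤ M := by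
    refine le_trans ?_ hM.le
    refine le_trans ?_ (ENNReal.le_tsum n)
    exact Finset.single_le_sum (f := fun k => (3 : ℝ≥0∞)⁻¹ ^ n * ENNReal.ofReal (ω (n, k) ^ 4))
      (fun _ _ => zero_le) (Finset.mem_range.2 hk)
  have h2 : ω (n, k) ^ 4 ≤ M * 3 ^ n := by
    have h3 : ENNReal.ofReal (ω (n, k) ^ 4) ≤ ENNReal.ofReal (M * 3 ^ n) := by
      rw [ENNReal.ofReal_mul (by positivity), ENNReal.ofReal_natCast,
        ENNReal.ofReal_pow (show (0:ℝ) ≤ 3 by norm_num), ENNReal.ofReal_ofNat]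
      rw [← ENNReal.inv_pow] at h1
      have := (ENNReal.inv_mul_le_iff (by simp) (by simp)).1 h1
      rwa [mul_comm]
    exact (ENNReal.ofReal_le_ofReal_iff (by positivity)).1 h3
  have h4 : |ω (n, k)| ^ 4 ≤ (((M + 1 : ℕ) : ℝ) * (4 / 3) ^ n) ^ 4 := by
    rw [Even.pow_abs (by decide), mul_pow]
    refine h2.trans ?_
    have a : (M : ℝ) ≤ ((M + 1 : ℕ) : ℝ) ^ 4 := by
      have : (1 : ℝ) ≤ ((M + 1 : ℕ) : ℝ) := by push_cast; linarith [M.cast_nonneg (α := ℝ)]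
      calc (M : ℝ) ≤ ((M + 1 : ℕ) : ℝ) := by push_cast; linarith
        _ ≤ _ := le_self_pow₀ this (by norm_num)
    have b : (3 : ℝ) ^ n ≤ ((4 / 3) ^ n) ^ 4 := by
      rw [← pow_mul, mul_comm, pow_mul]
      exact pow_le_pow_left₀ (by norm_num) (by norm_num) n
    exact mul_le_mul a b (by positivity) (by positivity)
  exact le_of_pow_le_pow_left₀ (by norm_num) (by positivity) h4

/-! ### The limit is Brownian -/

lemma charFunDual_centered {ι Ω : Type*} {mΩ : MeasurableSpace Ω} [Fintype ι] [DecidableEq ι]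
    {P : Measure Ω}
    {X : ι → Ω → ℝ} (hX : HasGaussianLaw (fun ω i => X i ω) P) (h0 : ∀ i, ∫ ω, X i ω ∂P = 0)
    (L : StrongDual ℝ (ι → ℝ)) :
    charFunDual (P.map (fun ω i => X i ω)) L =
      Complex.exp (-((∑ i, ∑ j, L (Pi.single i 1) * L (Pi.single j 1) * cov[X i, X j; P] : ℝ) : ℂ) / 2) := by
  have := hX.isProbabilityMeasure
  have hev : ∀ i, HasGaussianLaw (X i) P := fun i =>
    hX.map_fun (ContinuousLinearMap.proj (R := ℝ) (φ := fun _ : ι => ℝ) i)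
  have hL : ∀ x : ι → ℝ, L x = ∑ i, L (Pi.single i 1) * x i := by
    intro x
    conv_lhs => rw [← Finset.univ_sum_single x, map_sum]
    refine Finset.sum_congr rfl fun i _ => ?_
    rw [show Pi.single i (x i) = x i • (Pi.single i (1 : ℝ) : ι → ℝ) by
      rw [← Pi.single_smul]; simp]
    rw [map_smul, smul_eq_mul, mul_comm]
  rw [hX.charFunDual_map_eq_fun]
  have hmem : ∀ i, MemLp (fun ω => L (Pi.single i 1) * X i ω) 2 P := fun i =>
    (hev i).memLp_two.const_mul _
  have hmean : ∫ ω, L (fun i => X i ω) ∂P = 0 := by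
    have : (fun ω => L (fun i => X i ω)) = fun ω => ∑ i, L (Pi.single i 1) * X i ω := by
      ext ω; rw [hL]
    rw [this]
    rw [integral_finsetSum _ fun i _ => ((hev i).integrable.const_mul _)]
    refine Finset.sum_eq_zero fun i _ => ?_
    rw [integral_const_mul, h0, mul_zero]
  have hvar : Var[fun ω => L (fun i => X i ω); P] =
      ∑ i, ∑ j, L (Pi.single i 1) * L (Pi.single j 1) * cov[X i, X j; P] := by
    rw [← covariance_self (hX.map_fun L).aemeasurable]
    have : (fun ω => L (fun i => X i ω)) = fun ω => ∑ i, L (Pi.single i 1) * X i ω := by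
      ext ω; rw [hL]
    rw [this, covariance_fun_sum_fun_sum hmem hmem]
    refine Finset.sum_congr rfl fun i _ => Finset.sum_congr rfl fun j _ => ?_
    rw [covariance_const_mul_left, covariance_const_mul_right]; ring
  rw [hmean, hvar]
  congr 1
  simp; ring

lemma coord_indep : iIndepFun (fun (p : ℕ × ℕ) (ω : Om) => ω p) PP :=
  iIndepFun_infinitePi (X := fun _ x => x) (fun _ => measurable_id)

lemma coord_gauss (p : ℕ × ℕ) : HasGaussianLaw (fun ω : Om => ω p) PP :=
  (coord_law p).hasGaussianLaw

lemma coord_process : IsGaussianProcess (fun (p : ℕ × ℕ) (ω : Om) => ω p) PP where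
  hasGaussianLaw I := by
    have := coord_indep.precomp (g := fun i : I => i.1) Subtype.val_injective
    exact iIndepFun.hasGaussianLaw (fun i : I => coord_gauss i.1) this

lemma coord_cov (p q : ℕ × ℕ) : cov[fun ω : Om => ω p, fun ω : Om => ω q; PP] =
    if p = q then 1 else 0 := by
  split_ifs with h
  · subst h
    rw [covariance_self (coord_law p).aemeasurable, (coord_law p).variance_eq]
    simp
  · exact (coord_indep.indepFun h).covariance_eq_zero (coord_gauss p).memLp_two
      (coord_gauss q).memLp_two

/-- Coefficients of the partial sums. -/
def cf (t : ℝ≥0) (p : ℕ × ℕ) : ℝ :=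
  (1 + (t : ℝ)) * ((√2)⁻¹ ^ p.1 / 2) * if p.2 < 2 ^ p.1 then tent (2 ^ p.1 * tau t - p.2) else 0

/-- Index set of the partial sums. -/
def JJ (N : ℕ) : Finset (ℕ × ℕ) := Finset.range N ×ˢ Finset.range (2 ^ N)

lemma sum_trunc {N n : ℕ} (hn : n ∈ Finset.range N) (f : ℕ → ℝ) :
    ∑ k ∈ Finset.range (2 ^ N), (if k < 2 ^ n then f k else 0) = ∑ k ∈ Finset.range (2 ^ n), f k := by
  rw [← Finset.sum_filter]
  refine Finset.sum_congr ?_ fun _ _ => rfl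
  ext k
  simp only [Finset.mem_filter, Finset.mem_range]
  have : 2 ^ n ≤ 2 ^ N := Nat.pow_le_pow_right (by norm_num) (Finset.mem_range.1 hn).le
  omega

lemma BN_eq (N : ℕ) (t : ℝ≥0) (ω : Om) : BN N t ω = ∑ p ∈ JJ N, cf t p * ω p := by
  unfold BN JJ cf lev
  rw [Finset.sum_product, Finset.mul_sum]
  refine Finset.sum_congr rfl fun n hn => ?_
  rw [← sum_trunc hn, ← mul_assoc, Finset.mul_sum]
  refine Finset.sum_congr rfl fun k _ => ?_
  dsimp only
  split_ifs <;> ring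

lemma BN_process (N : ℕ) : IsGaussianProcess (BN N) PP := by
  refine coord_process.of_isGaussianProcess fun t => ⟨JJ N,
    ∑ p : JJ N, cf t p • ContinuousLinearMap.proj (R := ℝ) (φ := fun _ : JJ N => ℝ) p, fun ω => ?_⟩
  rw [BN_eq, ← Finset.sum_coe_sort]
  simp

lemma BN_mean (N : ℕ) (t : ℝ≥0) : ∫ ω, BN N t ω ∂PP = 0 := by
  simp_rw [BN_eq]
  rw [integral_finsetSum _ fun p _ => (coord_gauss p).integrable.const_mul _]
  refine Finset.sum_eq_zero fun p _ => ?_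
  rw [integral_const_mul, (coord_law p).integral_eq]
  simp

lemma BN_cov (N : ℕ) (s t : ℝ≥0) : cov[BN N s, BN N t; PP] =
    (1 + (s : ℝ)) * (1 + t) * KN N (tau s) (tau t) := by
  have h : ∀ t, BN N t = fun ω => ∑ p ∈ JJ N, cf t p * ω p := fun t => funext (BN_eq N t)
  have hm : ∀ t, ∀ p ∈ JJ N, MemLp (fun ω : Om => cf t p * ω p) 2 PP :=
    fun t p _ => (coord_gauss p).memLp_two.const_mul _
  rw [h, h, covariance_fun_sum_fun_sum' (hm s) (hm t)]
  simp_rw [covariance_const_mul_left, covariance_const_mul_right, coord_cov]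
  simp only [mul_ite, mul_one, mul_zero, Finset.sum_ite_eq]
  rw [Finset.sum_congr rfl fun p hp => if_pos hp]
  unfold JJ KN
  rw [Finset.sum_product, Finset.mul_sum]
  refine Finset.sum_congr rfl fun n hn => ?_
  rw [← sum_trunc hn, Finset.mul_sum, Finset.mul_sum]
  refine Finset.sum_congr rfl fun k _ => ?_
  unfold cf
  dsimp only
  have h2 : (1 / 2 : ℝ) ^ n = (√2)⁻¹ ^ n * (√2)⁻¹ ^ n := by
    rw [← mul_pow, ← mul_inv, Real.mul_self_sqrt (by norm_num)]; norm_num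
  rw [h2]
  split_ifs <;> ring

lemma BN_cov_tendsto (s t : ℝ≥0) :
    Tendsto (fun N => cov[BN N s, BN N t; PP]) atTop (nhds (min (s : ℝ) t)) := by
  simp_rw [BN_cov]
  have := (KN_tendsto (tau s) (tau t)).const_mul ((1 + (s : ℝ)) * (1 + t))
  convert this using 2
  rcases le_total s t with h | h
  · rw [GG_tau s t (by exact_mod_cast h), min_eq_left (by exact_mod_cast h)]
  · rw [GG_comm, mul_comm (1 + (s : ℝ)), GG_tau t s (by exact_mod_cast h),
      min_eq_right (by exact_mod_cast h)]

lemma BB_pre : IsPreBrownianReal BB PP where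
  hasLaw I := by
    have hmB : Measurable fun ω => (fun i : I => BB i ω) := measurable_pi_lambda _ fun i => BB_meas i
    refine ⟨hmB.aemeasurable, ?_⟩
    change PP.map (fun ω => (fun i : I => BB i ω)) = _
    have : IsProbabilityMeasure (PP.map (fun ω => (fun i : I => BB i ω))) :=
      Measure.isProbabilityMeasure_map hmB.aemeasurable
    refine Measure.ext_of_charFunDual (funext fun L => ?_)
    have hR : charFunDual (BrownianReal.projectiveFamily I) L = Complex.exp (-((∑ i : I, ∑ j : I,
        L (Pi.single i 1) * L (Pi.single j 1) * min (i.1 : ℝ) j.1 : ℝ) : ℂ) / 2) := by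
      have h := charFunDual_centered (P := BrownianReal.projectiveFamily I)
        (X := fun (i : I) (x : I → ℝ) => x i) (IsGaussian.hasGaussianLaw_id)
        (fun i => BrownianReal.integral_eval_projectiveFamily I i) L
      have h' : Measure.map (fun (ω : I → ℝ) i => ω i) (BrownianReal.projectiveFamily I)
        = BrownianReal.projectiveFamily I := Measure.map_id
      rw [h'] at h
      rw [h]
      simp_rw [BrownianReal.covariance_eval_projectiveFamily]
      simp
    have hN : ∀ N, charFunDual (PP.map (fun ω => (fun i : I => BN N i ω))) L =
        Complex.exp (-((∑ i : I, ∑ j : I,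
        L (Pi.single i 1) * L (Pi.single j 1) * cov[BN N i, BN N j; PP] : ℝ) : ℂ) / 2) := fun N =>
      charFunDual_centered (X := fun i : I => BN N i) ((BN_process N).hasGaussianLaw I)
        (fun i => BN_mean N i) L
    have hlim1 : Tendsto (fun N => charFunDual (PP.map (fun ω => (fun i : I => BN N i ω))) L) atTop
        (nhds (charFunDual (BrownianReal.projectiveFamily I) L)) := by
      rw [hR]
      simp_rw [hN]
      refine (Complex.continuous_exp.tendsto _).comp ?_
      refine Tendsto.div_const (Tendsto.neg ?_) _
      refine (Complex.continuous_ofReal.tendsto _).comp ?_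
      refine tendsto_finsetSum _ fun i _ => tendsto_finsetSum _ fun j _ => ?_
      exact (BN_cov_tendsto i j).const_mul _
    have hlim2 : Tendsto (fun N => charFunDual (PP.map (fun ω => (fun i : I => BN N i ω))) L) atTop
        (nhds (charFunDual (PP.map (fun ω => (fun i : I => BB i ω))) L)) := by
      have hmN : ∀ N, Measurable fun ω => (fun i : I => BN N i ω) :=
        fun N => measurable_pi_lambda _ fun i => BN_meas N i
      have hc : Continuous fun v : I → ℝ => Complex.exp (L v * Complex.I) := by fun_prop
      simp_rw [charFunDual_apply]
      rw [integral_map hmB.aemeasurable hc.aestronglyMeasurable]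
      refine Tendsto.congr (fun N => (integral_map (hmN N).aemeasurable
        hc.aestronglyMeasurable).symm) ?_
      refine tendsto_integral_of_dominated_convergence (fun _ => 1) ?_ ?_ ?_ ?_
      · exact fun N => (hc.measurable.comp (hmN N)).aestronglyMeasurable
      · exact integrable_const _
      · intro N
        exact ae_of_all _ fun ω => (Complex.norm_exp_ofReal_mul_I _).le
      · filter_upwards [ae_good] with ω hω
        refine (hc.tendsto _).comp ?_
        rw [tendsto_pi_nhds]
        exact fun i => BN_tendsto hω i
    exact tendsto_nhds_unique hlim2 hlim1

/-! ### Consequences for continuous pre-Brownian motions -/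

/-- Rapidly growing times. -/
def tk : ℕ → ℝ≥0
  | 0 => 1
  | k + 1 => tk k + 2 ^ k * tk k

lemma tk_one_le (k : ℕ) : 1 ≤ tk k := by
  induction k with
  | zero => exact le_rfl
  | succ k ih => exact ih.trans (by rw [tk]; exact le_self_add)

lemma tk_mono : Monotone tk := monotone_nat_of_le_succ fun k => by rw [tk]; exact le_self_add

lemma gauss_tail (v : ℝ≥0) :
    gaussianReal 0 1 (Iic (-1)) ≤ gaussianReal 0 v (Iic (-√v)) := by
  have h := gaussianReal_map_const_mul (μ := 0) (v := 1) (√(v : ℝ))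
  have hv : (NNReal.mk (√(v : ℝ) ^ 2) (sq_nonneg _) * 1 : ℝ≥0) = v := by
    ext; simp
  rw [hv, mul_zero] at h
  rw [← h, Measure.map_apply (by fun_prop) measurableSet_Iic]
  refine measure_mono fun x hx => ?_
  simp only [mem_Iic, mem_preimage] at hx ⊢
  nlinarith [Real.sqrt_nonneg (v : ℝ)]

lemma gauss_tail_pos : gaussianReal 0 1 (Iic (-1)) ≠ 0 := by
  intro h
  have := gaussianReal_absolutelyContinuous' 0 (one_ne_zero) h
  simp at this

lemma exists_neg {Ω : Type*} {mΩ : MeasurableSpace Ω} {P : Measure Ω} [IsProbabilityMeasure P]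
    {B : ℝ≥0 → Ω → ℝ} (hB : IsPreBrownianReal B P) (hm : ∀ t, Measurable (B t)) :
    ∀ᵐ ω ∂P, ∃ t : ℝ≥0, 1 ≤ t ∧ B t ω < 0 := by
  set D : ℕ → Ω → ℝ := fun i ω => B (tk (i + 1)) ω - B (tk i) ω with hD
  have hDm : ∀ i, Measurable (D i) := fun i => (hm _).sub (hm _)
  have hind : iIndepFun D P := hB.hasIndepIncrements.nat tk_mono
  set a : ℕ → ℝ≥0 := fun k => 2 ^ k * tk k with ha
  have hlaw : ∀ k, HasLaw (D k) (gaussianReal 0 (a k)) P := by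
    intro k
    have := hB.hasLaw_sub (tk (k + 1)) (tk k)
    have e : nndist (tk (k + 1)).1 (tk k).1 = a k := by
      ext
      rw [coe_nndist, Real.dist_eq]
      have : (tk (k + 1)).1 - (tk k).1 = (a k : ℝ) := by
        simp [tk, ha]
      rw [this]; exact abs_of_nonneg (a k).coe_nonneg
    rw [e] at this
    exact this
  set E : ℕ → Set Ω := fun k => D k ⁻¹' Iic (-√(a k)) with hE
  have hEm : ∀ k, MeasurableSet (E k) := fun k => hDm k measurableSet_Iic
  have hEind : iIndepSet E P := by
    rw [iIndepSet_iff_meas_biInter hEm]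
    intro s
    exact hind.measure_inter_preimage_eq_mul s (fun i _ => measurableSet_Iic)
  have hEP : ∀ k, gaussianReal 0 1 (Iic (-1)) ≤ P (E k) := by
    intro k
    rw [hE, ← Measure.map_apply (hDm k) measurableSet_Iic, (hlaw k).map_eq]
    exact gauss_tail _
  have hsum : ∑' k, P (E k) = ⊤ := by
    rw [eq_top_iff, ← ENNReal.tsum_const_eq_top_of_ne_zero (α := ℕ) gauss_tail_pos]
    exact ENNReal.tsum_le_tsum hEP
  have hio : ∀ᵐ ω ∂P, ∃ᶠ k in atTop, ω ∈ E k := by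
    have h1 := measure_limsup_eq_one hEm hEind hsum
    have h2 : ∀ᵐ ω ∂P, ω ∈ limsup E atTop :=
      (mem_ae_iff_prob_eq_one (MeasurableSet.measurableSet_limsup hEm)).2 h1
    filter_upwards [h2] with ω hω
    exact mem_limsup_iff_frequently_mem.1 hω
  set H : ℕ → Set Ω := fun k => {ω | √(a k) ≤ |B (tk k) ω|} with hH
  have hapos : ∀ k, 0 < a k := fun k =>
    mul_pos (by positivity) (lt_of_lt_of_le one_pos (tk_one_le k))
  have hHP : ∀ k, P (H k) ≤ 2⁻¹ ^ k := by
    intro k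
    have hl := hB.hasLaw_eval (tk k)
    have h := meas_ge_le_variance_div_sq (μ := P) (X := B (tk k))
      hl.hasGaussianLaw.memLp_two (Real.sqrt_pos.2 (NNReal.coe_pos.2 (hapos k)))
    rw [hB.integral_eval, hl.variance_eq, Real.sq_sqrt (a k).coe_nonneg] at h
    simp only [sub_zero, variance_id_gaussianReal] at h
    refine h.trans_eq ?_
    have htk : (tk k : ℝ) ≠ 0 := by
      have := lt_of_lt_of_le one_pos (tk_one_le k)
      exact_mod_cast this.ne'
    have : (tk k : ℝ) / (a k : ℝ) = 2⁻¹ ^ k := by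
      simp only [ha, NNReal.coe_mul, NNReal.coe_pow, NNReal.coe_ofNat]
      field_simp
      rw [← mul_pow]; norm_num
    rw [this, ENNReal.ofReal_pow (by norm_num), ENNReal.ofReal_inv_of_pos (by norm_num)]
    simp
  have hHsum : ∑' k, P (H k) ≠ ⊤ := by
    refine ne_top_of_le_ne_top ?_ (ENNReal.tsum_le_tsum hHP)
    rw [ENNReal.tsum_geometric]
    refine ENNReal.inv_ne_top.2 (tsub_pos_of_lt ?_).ne'
    simp
  filter_upwards [hio, ae_eventually_notMem hHsum] with ω h1 h2
  obtain ⟨k, hk1, hk2⟩ := (h1.and_eventually h2).exists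
  refine ⟨tk (k + 1), tk_one_le _, ?_⟩
  simp only [hE, hH, hD, mem_preimage, mem_Iic, mem_ofPred_eq, not_le] at hk1 hk2
  linarith [le_abs_self (B (tk k) ω)]

lemma exists_zero {Ω : Type*} {mΩ : MeasurableSpace Ω} {P : Measure Ω} [IsProbabilityMeasure P]
    {B : ℝ≥0 → Ω → ℝ} (hB : IsPreBrownianReal B P) (hm : ∀ t, Measurable (B t))
    (hc : ∀ ω, Continuous fun t => B t ω) :
    ∀ᵐ ω ∂P, ∃ t : ℝ≥0, 1 ≤ t ∧ B t ω = 0 := by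
  filter_upwards [exists_neg hB hm, exists_neg hB.neg (fun t => (hm t).neg)] with ω h1 h2
  obtain ⟨s, hs, hs'⟩ := h1
  obtain ⟨t, ht, ht'⟩ := h2
  simp only [Pi.neg_apply, neg_lt_zero] at ht'
  obtain ⟨r, hr, hrz⟩ := isPreconnected_Ici.intermediate_value (s := Ici (1 : ℝ≥0)) hs ht
    (hc ω).continuousOn ⟨hs'.le, ht'.le⟩
  exact ⟨r, hr, hrz⟩

/-- The natural filtration. -/
def natF {Ω : Type*} {mΩ : MeasurableSpace Ω} (B : ℝ≥0 → Ω → ℝ) (hm : ∀ t, Measurable (B t)) :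
    Filtration ℝ≥0 mΩ where
  seq t := MeasurableSpace.comap (fun ω (s : Iic t) => B s ω) inferInstance
  mono' s t hst := by
    have : (fun ω (r : Iic s) => B r ω) =
      (fun (f : Iic t → ℝ) (r : Iic s) => f ⟨r.1, r.2.trans hst⟩) ∘ (fun ω (r : Iic t) => B r ω) :=
        rfl
    show MeasurableSpace.comap _ _ ≤ MeasurableSpace.comap _ _
    rw [this, ← MeasurableSpace.comap_comp]
    refine MeasurableSpace.comap_mono ?_
    rw [← measurable_iff_comap_le]
    fun_prop
  le' t := by
    rw [← measurable_iff_comap_le]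
    exact measurable_pi_lambda _ fun s => hm s

lemma natF_meas {Ω : Type*} {mΩ : MeasurableSpace Ω} {B : ℝ≥0 → Ω → ℝ}
    (hm : ∀ t, Measurable (B t)) {s t : ℝ≥0} (h : s ≤ t) : Measurable[natF B hm t] (B s) := by
  have h1 : Measurable[natF B hm t] (fun ω (r : Iic t) => B r ω) := comap_measurable _
  exact (measurable_pi_apply (⟨s, h⟩ : Iic t)).comp h1

lemma natF_increments {Ω : Type*} {mΩ : MeasurableSpace Ω} {P : Measure Ω}
    {B : ℝ≥0 → Ω → ℝ} (hB : IsPreBrownianReal B P) (hm : ∀ t, Measurable (B t))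
    (s t : ℝ≥0) (hst : s ≤ t) (g : ℝ → ℝ≥0∞) (hg : Measurable g)
    (A : Set Ω) (hA : MeasurableSet[natF B hm s] A) :
    ∫⁻ ω in A, g (B t ω - B s ω) ∂P = P A * ∫⁻ ω, g (B (t - s) ω) ∂P := by
  have hAm : MeasurableSet A := (natF B hm).le s _ hA
  obtain ⟨A', hA', rfl⟩ := hA
  have hind := hB.indepFun_shift s
  have hIm : Measurable (A'.indicator (fun _ => (1 : ℝ≥0∞))) := measurable_const.indicator hA'
  have hind2 := hind.comp (φ := fun f : ℝ≥0 → ℝ => g (f (t - s)))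
    (ψ := A'.indicator (fun _ => (1 : ℝ≥0∞))) (by fun_prop) hIm
  have hts : s + (t - s) = t := add_tsub_cancel_of_le hst
  have hR : Measurable (fun ω (r : Iic s) => B r ω) := measurable_pi_lambda _ fun r => hm r
  have hDm : Measurable (fun ω => g (B t ω - B s ω)) := hg.comp ((hm t).sub (hm s))
  have hprod := lintegral_mul_eq_lintegral_mul_lintegral_of_indepFun
    (by simp only [Function.comp_def, hts]; exact hDm)
    (hIm.comp hR) hind2
  simp only [Function.comp_def, Pi.mul_apply, hts] at hprod
  rw [← lintegral_indicator hAm]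
  have e1 : ∀ ω, ((fun ω (r : Iic s) => B r ω) ⁻¹' A').indicator
      (fun ω => g (B t ω - B s ω)) ω =
      g (B t ω - B s ω) * A'.indicator (fun _ => 1) (fun r : Iic s => B r ω) := by
    intro ω
    by_cases h : (fun r : Iic s => B r ω) ∈ A'
    · rw [indicator_of_mem (by exact h), indicator_of_mem h, mul_one]
    · rw [indicator_of_notMem (by exact h), indicator_of_notMem h, mul_zero]
  rw [lintegral_congr e1, hprod, mul_comm]
  congr 1
  · have e2 : ∀ ω, A'.indicator (fun _ => (1 : ℝ≥0∞)) (fun r : Iic s => B r ω) =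
      ((fun ω (r : Iic s) => B r ω) ⁻¹' A').indicator (fun _ => 1) ω := fun ω => rfl
    rw [lintegral_congr e2, lintegral_indicator hAm]
    simp
  · have h1 := (hB.hasLaw_sub t s).lintegral_comp hg.aemeasurable
    have h2 := (hB.hasLaw_eval (t - s)).lintegral_comp hg.aemeasurable
    have e : nndist t.1 s.1 = t - s := by
      ext
      rw [coe_nndist, Real.dist_eq, NNReal.coe_sub hst]
      exact abs_of_nonneg (sub_nonneg.2 (NNReal.coe_le_coe.2 hst))
    rw [e] at h1
    rw [h2]
    exact h1


/-! ### The hitting time -/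

/-- First zero after time one. -/
def hit (f : ℝ≥0 → ℝ) : ℝ≥0∞ := sInf {t : ℝ≥0∞ | 1 ≤ t ∧ t ≠ ⊤ ∧ f t.toNNReal = 0}

lemma hit_isLeast {f : ℝ≥0 → ℝ} (hf : Continuous f) {r : ℝ≥0} (h1 : 1 ≤ r) (h2 : f r = 0) :
    ∃ m : ℝ≥0, hit f = m ∧ f m = 0 ∧ 1 ≤ m ∧ m ≤ r := by
  have hcl : IsClosed {r : ℝ≥0 | 1 ≤ r ∧ f r = 0} :=
    (isClosed_le continuous_const continuous_id).inter (isClosed_eq hf continuous_const)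
  have hmem := hcl.csInf_mem ⟨r, h1, h2⟩ (OrderBot.bddBelow _)
  refine ⟨sInf {r : ℝ≥0 | 1 ≤ r ∧ f r = 0}, ?_, hmem.2, hmem.1,
    csInf_le (OrderBot.bddBelow _) ⟨h1, h2⟩⟩
  refine IsLeast.csInf_eq ⟨⟨by exact_mod_cast hmem.1, by simp, by simpa using hmem.2⟩, ?_⟩
  rintro t ⟨ht1, ht2, ht3⟩
  lift t to ℝ≥0 using ht2
  have : sInf {r : ℝ≥0 | 1 ≤ r ∧ f r = 0} ≤ t :=
    csInf_le (OrderBot.bddBelow _) ⟨by exact_mod_cast ht1, by simpa using ht3⟩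
  exact_mod_cast this

lemma hit_lt_top {f : ℝ≥0 → ℝ} (h : hit f < ⊤) : ∃ r : ℝ≥0, 1 ≤ r ∧ f r = 0 := by
  by_contra! hc
  have : {t : ℝ≥0∞ | 1 ≤ t ∧ t ≠ ⊤ ∧ f t.toNNReal = 0} = ∅ := by
    ext t
    simp only [mem_ofPred_eq, mem_empty_iff_false, iff_false]
    rintro ⟨ht1, ht2, ht3⟩
    lift t to ℝ≥0 using ht2
    exact hc t (by exact_mod_cast ht1) (by simpa using ht3)
  rw [hit, this] at h
  simp at h

lemma hit_le_iff {f : ℝ≥0 → ℝ} (hf : Continuous f) (t : ℝ≥0) :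
    hit f ≤ t ↔ ∃ r : Icc 1 t, f r = 0 := by
  constructor
  · intro h
    obtain ⟨r, h1, h2⟩ := hit_lt_top (lt_of_le_of_lt h ENNReal.coe_lt_top)
    obtain ⟨m, hm, hm0, hm1, -⟩ := hit_isLeast hf h1 h2
    rw [hm] at h
    exact ⟨⟨m, hm1, by exact_mod_cast h⟩, hm0⟩
  · rintro ⟨⟨r, h1, h2⟩, h3⟩
    obtain ⟨m, hm, hm0, hm1, hmr⟩ := hit_isLeast hf h1 h3
    rw [hm]
    exact_mod_cast hmr.trans h2

lemma zero_iff_approx {f : ℝ≥0 → ℝ} (hf : Continuous f) (t : ℝ≥0) {D : Set (Icc 1 t)}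
    (hD : Dense D) : (∃ r : Icc 1 t, f r = 0) ↔ ∀ n : ℕ, ∃ q ∈ D, |f q| < 1 / ((n : ℝ) + 1) := by
  have hg : Continuous fun r : Icc 1 t => |f r| := by fun_prop
  constructor
  · rintro ⟨r, hr⟩ n
    have ho : IsOpen {q : Icc 1 t | |f q| < 1 / ((n : ℝ) + 1)} := isOpen_lt hg continuous_const
    obtain ⟨q, hq1, hq2⟩ := hD.inter_open_nonempty _ ho
      ⟨r, by simp only [mem_ofPred_eq, hr, abs_zero]; positivity⟩
    exact ⟨q, hq2, hq1⟩
  · intro h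
    obtain ⟨q0, -, -⟩ := h 0
    have : Nonempty (Icc 1 t) := ⟨q0⟩
    obtain ⟨r, -, hr⟩ := isCompact_univ.exists_isMinOn (univ_nonempty) hg.continuousOn
    refine ⟨r, ?_⟩
    rw [← abs_nonpos_iff]
    refine le_of_forall_pos_lt_add fun ε hε => ?_
    obtain ⟨n, hn⟩ := exists_nat_one_div_lt hε
    obtain ⟨q, -, hq⟩ := h n
    have := hr (mem_univ q)
    simp only [mem_ofPred_eq] at this
    linarith

lemma hit_stopping {Ω : Type*} {mΩ : MeasurableSpace Ω} {B : ℝ≥0 → Ω → ℝ}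
    (hm : ∀ t, Measurable (B t)) (hc : ∀ ω, Continuous fun t => B t ω) (t : ℝ≥0) :
    MeasurableSet[natF B hm t] {ω | hit (fun t => B t ω) ≤ t} := by
  obtain ⟨D, hDc, hDd⟩ := TopologicalSpace.exists_countable_dense (Icc 1 t)
  have : {ω | hit (fun t => B t ω) ≤ t} =
      ⋂ n : ℕ, ⋃ q ∈ D, {ω | |B q ω| < 1 / ((n : ℝ) + 1)} := by
    ext ω
    simp only [mem_ofPred_eq, mem_iInter, mem_iUnion, exists_prop]
    rw [hit_le_iff (hc ω), zero_iff_approx (hc ω) t hDd]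
  rw [this]
  refine MeasurableSet.iInter fun n => MeasurableSet.biUnion hDc fun q _ => ?_
  have h1 : Measurable[natF B hm t] fun ω => |B q ω| :=
    continuous_abs.measurable.comp (natF_meas hm q.2.2)
  exact measurableSet_lt h1 measurable_const

lemma BB_levy : IsLevy PP (natF BB BB_meas) BB where
  adapted t := natF_meas BB_meas le_rfl
  rightCont ω t := (BB_cont ω).continuousWithinAt
  leftLim ω t _ := ⟨BB t ω, ((BB_cont ω).tendsto t).mono_left nhdsWithin_le_nhds⟩
  init := BB_pre.eval_zero_ae_eq_zero
  increments s t hst g hg A hA := natF_increments BB_pre BB_meas s t hst g hg A hA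

lemma zero_levy {Ω : Type*} {mΩ : MeasurableSpace Ω} (P : Measure Ω) [IsProbabilityMeasure P]
    (F : Filtration ℝ≥0 mΩ) : IsLevy P F (fun _ _ => (0 : ℝ)) where
  adapted t := measurable_const
  rightCont ω t := continuous_const.continuousWithinAt
  leftLim ω t _ := ⟨0, tendsto_const_nhds⟩
  init := ae_of_all _ fun _ => rfl
  increments s t hst g hg A hA := by
    simp [mul_comm]

lemma BB_law_ne : Measure.map (fun ω (t : ℝ≥0) => BB t ω) PP
    ≠ Measure.map (fun (_ : Om) (_ : ℝ≥0) => (0 : ℝ)) PP := by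
  intro h
  have hB : Measurable fun ω (t : ℝ≥0) => BB t ω := measurable_pi_lambda _ BB_meas
  have h1 := congrArg (Measure.map (fun f : ℝ≥0 → ℝ => f 1)) h
  rw [Measure.map_map (by fun_prop) hB, Measure.map_map (by fun_prop) measurable_const] at h1
  have h2 : Measure.map (BB 1) PP = Measure.map (fun _ : Om => (0 : ℝ)) PP := h1
  rw [(BB_pre.hasLaw_eval 1).map_eq, Measure.map_const, measure_univ, one_smul,
    ← gaussianReal_zero_var 0, gaussianReal_ext_iff] at h2
  exact one_ne_zero h2.2

/-- The stopping time. -/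
def SS (ω : Om) : ℝ≥0∞ := hit fun t => BB t ω

lemma SS_lt_top : ∀ᵐ ω ∂PP, SS ω < ⊤ := by
  filter_upwards [exists_zero BB_pre BB_meas BB_cont] with ω ⟨r, h1, h2⟩
  obtain ⟨m, hm, -⟩ := hit_isLeast (BB_cont ω) h1 h2
  rw [SS, hm]
  exact ENNReal.coe_lt_top

lemma SS_zero (ω : Om) (h : SS ω < ⊤) : BB (SS ω).toNNReal ω = 0 := by
  obtain ⟨r, h1, h2⟩ := hit_lt_top h
  obtain ⟨m, hm, hm0, -⟩ := hit_isLeast (BB_cont ω) h1 h2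
  rw [SS, hm]
  simpa using hm0

lemma SS_isStopping : IsStoppingTimeE (natF BB BB_meas) SS := fun t => hit_stopping BB_meas BB_cont t

lemma SS_map : (fun ω => (SS ω, if SS ω < ⊤ then BB (SS ω).toNNReal ω else 0))
    = fun ω => (SS ω, (0 : ℝ)) := by
  ext ω : 1
  split_ifs with h
  · rw [SS_zero ω h]
  · rfl

/-- There is a Brownian motion `B` and an a.s. finite stopping time `S`
(the first hitting time of `0` after time `1`) such that `B_S 1_{S<∞} = 0` a.s., and
`(S, B_S 1_{S<∞})` has the same law as `(S, 0_S 1_{S<∞})`, while `B` and the zero process do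
not have the same law. Hence equality of the laws of `(X¹_{T¹} 1_{T¹<∞}, T¹)` and
`(X²_{T²} 1_{T²<∞}, T²)` for stopping times does not imply equality of the laws of `X¹`, `X²`. -/
theorem observation_at_stopping_time_insufficient :
    (∃ (Ω : Type) (mΩ : MeasurableSpace Ω) (P : Measure Ω) (_ : IsProbabilityMeasure P)
        (F : Filtration ℝ≥0 mΩ) (B : ℝ≥0 → Ω → ℝ) (S : Ω → ℝ≥0∞),
      IsBM P F B ∧
      S = (fun ω => sInf {t : ℝ≥0∞ | 1 ≤ t ∧ t ≠ ⊤ ∧ B t.toNNReal ω = 0}) ∧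
      IsStoppingTimeE F S ∧
      (∀ᵐ ω ∂P, S ω < ⊤) ∧
      (∀ᵐ ω ∂P, S ω < ⊤ → B (S ω).toNNReal ω = 0) ∧
      Measure.map (fun ω => (S ω, if S ω < ⊤ then B (S ω).toNNReal ω else 0)) P
        = Measure.map (fun ω => (S ω, (0 : ℝ))) P ∧
      Measure.map (fun ω (t : ℝ≥0) => B t ω) P
        ≠ Measure.map (fun (_ : Ω) (_ : ℝ≥0) => (0 : ℝ)) P) ∧
    ¬ (∀ (Ω₁ : Type) (mΩ₁ : MeasurableSpace Ω₁) (P₁ : Measure Ω₁),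
        IsProbabilityMeasure P₁ → ∀ (F₁ : Filtration ℝ≥0 mΩ₁) (X₁ : ℝ≥0 → Ω₁ → ℝ),
        IsLevy P₁ F₁ X₁ → ∀ T₁ : Ω₁ → ℝ≥0∞, IsStoppingTimeE F₁ T₁ → (∀ᵐ ω ∂P₁, T₁ ω < ⊤) →
        ∀ (Ω₂ : Type) (mΩ₂ : MeasurableSpace Ω₂) (P₂ : Measure Ω₂),
        IsProbabilityMeasure P₂ → ∀ (F₂ : Filtration ℝ≥0 mΩ₂) (X₂ : ℝ≥0 → Ω₂ → ℝ),
        IsLevy P₂ F₂ X₂ → ∀ T₂ : Ω₂ → ℝ≥0∞, IsStoppingTimeE F₂ T₂ → (∀ᵐ ω ∂P₂, T₂ ω < ⊤) →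
        Measure.map (fun ω => (T₁ ω, if T₁ ω < ⊤ then X₁ (T₁ ω).toNNReal ω else 0)) P₁
          = Measure.map (fun ω => (T₂ ω, if T₂ ω < ⊤ then X₂ (T₂ ω).toNNReal ω else 0)) P₂ →
        Measure.map (fun ω (t : ℝ≥0) => X₁ t ω) P₁
          = Measure.map (fun ω (t : ℝ≥0) => X₂ t ω) P₂) := by
  refine ⟨⟨Om, inferInstance, PP, inferInstance, natF BB BB_meas, BB, SS,
    ⟨BB_levy, BB_cont, fun t => (BB_pre.hasLaw_eval t).map_eq⟩, rfl, SS_isStopping, SS_lt_top,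
    ae_of_all _ SS_zero, by rw [SS_map], BB_law_ne⟩, fun h => ?_⟩
  refine BB_law_ne (h Om _ PP inferInstance _ BB BB_levy SS SS_isStopping SS_lt_top
    Om _ PP inferInstance _ _ (zero_levy PP (natF BB BB_meas)) SS SS_isStopping SS_lt_top ?_)
  rw [SS_map]
  simp

end
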